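/- arXiv:2510.12619 — 3 statements merged into one kernel-verified Lean document; each statement's English description precedes it below -/
import Mathlib

section
/- (Lemma 3.1, existential content of Sparsify-Types.) Let G be a finite simple graph, χ a proper partial edge coloring of G with palette C of size μ, 𝒰 a separable collection of u-fans of size λ, and η an integer with 10 ≤ η ≤ μ/10. Then there exist: a proper partial edge coloring χ′ of G with palette C having exactly the same set of uncolored edges as χ; pairwise disjoint subsets of colors 𝒞_1, …, 𝒞_η ⊆ C with |𝒞_k| ≤ μ/η for every k ∈ [η]; and a collection 𝒰′ of u-fans with respect to χ′ that is separable, has size |𝒰′| ≥ λ/100, and in which every u-fan has type in ⋃_{k=1}^η (𝒞_k × 𝒞_k). -/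
open Classical

/-- A partial edge coloring `χ` of a graph `G` is *proper* if no two distinct edges of `G`
sharing a vertex receive the same color. -/
def Proper {V C : Type*} (G : SimpleGraph V) (χ : Sym2 V → Option C) : Prop :=
  ∀ e₁ ∈ G.edgeSet, ∀ e₂ ∈ G.edgeSet, e₁ ≠ e₂ →
    (∃ x : V, x ∈ e₁ ∧ x ∈ e₂) → ∀ c : C, χ e₁ = some c → χ e₂ ≠ some c

/-- The set of uncolored edges of `G` under the partial coloring `χ`. -/
def uncolored {V C : Type*} (G : SimpleGraph V) (χ : Sym2 V → Option C) : Set (Sym2 V) :=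
  {e | e ∈ G.edgeSet ∧ χ e = none}

/-- `missing G χ u` is the set of colors not assigned by `χ` to any edge of `G` incident on `u`. -/
def missing {V C : Type*} (G : SimpleGraph V) (χ : Sym2 V → Option C) (u : V) : Set C :=
  {c | ∀ e ∈ G.edgeSet, u ∈ e → χ e ≠ some c}

/-- A u-fan: a center `u`, two leaves `v`, `w`, and assigned colors. -/
structure UFan (V : Type*) (C : Type*) where
  u : V
  v : V
  w : V
  cu : C
  cv : C
  cw : C

/-- The (uncolored) edges of a u-fan. -/
def UFan.edges {V C : Type*} (f : UFan V C) : Set (Sym2 V) := {s(f.u, f.v), s(f.u, f.w)}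

/-- `f.assigns x c` means that `x` is a vertex of `f` and `c` is the color `c_f(x)`
 that `f` assigns to `x`. -/
def UFan.assigns {V C : Type*} (f : UFan V C) (x : V) (c : C) : Prop :=
  (x = f.u ∧ c = f.cu) ∨ (x = f.v ∧ c = f.cv) ∨ (x = f.w ∧ c = f.cw)

/-- `f` is a u-fan with respect to the graph `G` and the proper partial coloring `χ`. -/
def IsUFan {V C : Type*} (G : SimpleGraph V) (χ : Sym2 V → Option C) (f : UFan V C) : Prop :=
  f.u ≠ f.v ∧ f.u ≠ f.w ∧ f.v ≠ f.w ∧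
  s(f.u, f.v) ∈ uncolored G χ ∧ s(f.u, f.w) ∈ uncolored G χ ∧
  f.cu ∈ missing G χ f.u ∧ f.cv ∈ missing G χ f.v ∧ f.cw ∈ missing G χ f.w ∧
  f.cu ≠ f.cv ∧ f.cv = f.cw

/-- A collection of u-fans is separable if the u-fans are pairwise edge-disjoint and,
for each vertex `x`, the colors assigned to `x` by the u-fans containing `x` are
pairwise distinct. -/
def Separable {V C : Type*} (𝒰 : Finset (UFan V C)) : Prop :=
  (∀ f ∈ 𝒰, ∀ g ∈ 𝒰, f ≠ g → Disjoint f.edges g.edges) ∧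
  (∀ f ∈ 𝒰, ∀ g ∈ 𝒰, f ≠ g → ∀ (x : V) (c : C), f.assigns x c → ¬ g.assigns x c)

namespace UFan

/-- The `i`-th vertex of a u-fan: the center, then the two leaves. -/
def vertex {V C : Type*} (f : UFan V C) : Fin 3 → V := ![f.u, f.v, f.w]

/-- The color that a u-fan assigns to its `i`-th vertex. -/
def color {V C : Type*} (f : UFan V C) : Fin 3 → C := ![f.cu, f.cv, f.cw]

theorem assigns_iff {V C : Type*} (f : UFan V C) (x : V) (c : C) :
    f.assigns x c ↔ ∃ i, f.vertex i = x ∧ f.color i = c := by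
  simp [assigns, vertex, color, Fin.exists_fin_succ, eq_comm]

end UFan

section Recoloring

variable {V C : Type*} {G : SimpleGraph V} {χ : Sym2 V → Option C}

theorem mem_missing_iff {x : V} {c : C} :
    c ∈ missing G χ x ↔ ∀ y, G.Adj x y → χ s(x, y) ≠ some c := by
  refine ⟨fun h y hy => h _ hy (by simp), fun h e he hx => ?_⟩
  obtain ⟨y, rfl⟩ := hx
  exact h y he

theorem proper_iff : Proper G χ ↔ ∀ x y z c, G.Adj x y → G.Adj x z →
    χ s(x, y) = some c → χ s(x, z) = some c → y = z := by
  constructor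
  · intro h x y z c hy hz hcy hcz
    by_contra hne
    exact h s(x, y) hy s(x, z) hz (fun h => hne (Sym2.congr_right.1 h)) ⟨x, by simp, by simp⟩ c hcy hcz
  · rintro h e₁ h₁ e₂ h₂ hne ⟨x, ⟨y, rfl⟩, ⟨z, rfl⟩⟩ c hcy hcz
    exact hne (by rw [h x y z c h₁ h₂ hcy hcz])

/-- Permuting the colors at each vertex, consistently along the edges, gives a recoloring. -/
theorem exists_recoloring (hχ : Proper G χ) (π : V → Equiv.Perm C)
    (hπ : ∀ x y c, G.Adj x y → χ s(x, y) = some c → π x c = π y c) :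
    ∃ χ' : Sym2 V → Option C, Proper G χ' ∧ uncolored G χ' = uncolored G χ ∧
      ∀ x c, c ∈ missing G χ x → π x c ∈ missing G χ' x := by
  let χ' : Sym2 V → Option C := fun e => (χ e).map (π (Quot.out e).1)
  have key : ∀ x y, G.Adj x y → χ' s(x, y) = (χ s(x, y)).map (π x) := by
    intro x y h
    have hm := Sym2.out_fst_mem s(x, y)
    rw [Sym2.mem_iff] at hm
    cases hc : χ s(x, y) with
    | none => simp [χ', hc]
    | some c =>
      rcases hm with hm | hm
      · simp [χ', hc, hm]
      · simp [χ', hc, hm, hπ x y c h hc]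
  refine ⟨χ', ?_, ?_, ?_⟩
  · rw [proper_iff] at hχ ⊢
    intro x y z c hy hz hcy hcz
    rw [key x y hy, Option.map_eq_some_iff] at hcy
    rw [key x z hz, Option.map_eq_some_iff] at hcz
    obtain ⟨a, ha, rfl⟩ := hcy
    obtain ⟨b, hb, hab⟩ := hcz
    obtain rfl := (π x).injective hab
    exact hχ x y z b hy hz ha hb
  · ext e
    simp [uncolored, χ']
  · intro x c hc
    rw [mem_missing_iff] at hc ⊢
    intro y hy h
    rw [key x y hy, Option.map_eq_some_iff] at h
    obtain ⟨a, ha, hac⟩ := h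
    obtain rfl := (π x).injective hac
    exact hc y hy ha

variable (G χ) in
/-- The subgraph of the edges colored `a` or `b`, whose components are the Kempe chains. -/
def kempeGraph (a b : C) : SimpleGraph V where
  Adj x y := G.Adj x y ∧ (χ s(x, y) = some a ∨ χ s(x, y) = some b)
  symm := ⟨fun x y h => by simpa [Sym2.eq_swap, G.adj_comm] using h⟩
  loopless := ⟨fun x h => G.loopless.irrefl x h.1⟩

/-- Each vertex of a Kempe chain has at most two missing colors and chain neighbors in total. -/
theorem card_missing_add_degree_le [Fintype V] (hχ : Proper G χ) (a b : C)
    (c : (kempeGraph G χ a b).ConnectedComponent) (y : c) :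
    ((({a, b} : Finset C).filter (· ∈ missing G χ y)).card + c.toSimpleGraph.degree y) ≤ 2 := by
  have h : c.toSimpleGraph.degree y ≤
      (({a, b} : Finset C).filter (¬ · ∈ missing G χ y)).card := by
    rw [← SimpleGraph.card_neighborFinset_eq_degree]
    refine Finset.card_le_card_of_forall_subsingleton
      (fun (q : c) d => χ s((y : V), (q : V)) = some d) ?_ ?_
    · intro q hq
      have hq : (kempeGraph G χ a b).Adj y q := (c.toSimpleGraph_adj y.2 q.2).1 (by simpa using hq)
      obtain ⟨hq, h | h⟩ := hq
      · refine ⟨a, ?_, h⟩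
        simp only [Finset.mem_filter, mem_missing_iff]
        exact ⟨by simp, fun h' => h' q hq h⟩
      · refine ⟨b, ?_, h⟩
        simp only [Finset.mem_filter, mem_missing_iff]
        exact ⟨by simp, fun h' => h' q hq h⟩
    · rintro d - p ⟨hp, hpd⟩ q ⟨hq, hqd⟩
      have hp : (kempeGraph G χ a b).Adj y p := (c.toSimpleGraph_adj y.2 p.2).1 (by simpa using hp)
      have hq : (kempeGraph G χ a b).Adj y q := (c.toSimpleGraph_adj y.2 q.2).1 (by simpa using hq)
      exact Subtype.ext (proper_iff.1 hχ y p q d hp.1 hq.1 hpd hqd)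
  have h2 : ({a, b} : Finset C).card ≤ 2 := Finset.card_le_two
  have h3 := Finset.card_filter_add_card_filter_not (s := ({a, b} : Finset C))
    (fun d => d ∈ missing G χ y)
  omega

/-- A Kempe chain has at most two ends. -/
theorem kempe_chain_ends [Fintype V] (hχ : Proper G χ) {a b c₁ c₂ c₃ : C} {x y z : V}
    (hy : (kempeGraph G χ a b).Reachable x y) (hz : (kempeGraph G χ a b).Reachable x z)
    (h₁ : c₁ ∈ missing G χ x) (h₂ : c₂ ∈ missing G χ y) (h₃ : c₃ ∈ missing G χ z)
    (hc₁ : c₁ = a ∨ c₁ = b) (hc₂ : c₂ = a ∨ c₂ = b) (hc₃ : c₃ = a ∨ c₃ = b) :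
    (x = y ∧ c₁ = c₂) ∨ (x = z ∧ c₁ = c₃) ∨ (y = z ∧ c₂ = c₃) := by
  set K := kempeGraph G χ a b
  let c := K.connectedComponentMk x
  have hxc : x ∈ c := rfl
  have hyc : y ∈ c := SimpleGraph.ConnectedComponent.eq.2 hy.symm
  have hzc : z ∈ c := SimpleGraph.ConnectedComponent.eq.2 hz.symm
  let ends : Finset (Σ _ : c, C) :=
    Finset.univ.sigma fun y : c => ({a, b} : Finset C).filter (· ∈ missing G χ y)
  have hends : ends.card ≤ 2 := by
    have h1 : ∑ y : c, ((({a, b} : Finset C).filter (· ∈ missing G χ y)).card +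
        c.toSimpleGraph.degree y) ≤ ∑ _y : c, 2 :=
      Finset.sum_le_sum fun y _ => card_missing_add_degree_le hχ a b c y
    rw [Finset.sum_add_distrib, SimpleGraph.sum_degrees_eq_twice_card_edges,
      ← Finset.card_sigma] at h1
    have h2 := c.connected_toSimpleGraph.card_vert_le_card_edgeSet_add_one
    rw [Nat.card_eq_fintype_card, Nat.card_eq_fintype_card, SimpleGraph.card_edgeSet] at h2
    simp only [Finset.sum_const, Finset.card_univ, smul_eq_mul] at h1
    change ends.card + _ ≤ _ at h1
    omega
  by_contra! hne
  refine absurd (Finset.two_lt_card.2 ⟨⟨⟨x, hxc⟩, c₁⟩, ?_, ⟨⟨y, hyc⟩, c₂⟩, ?_, ⟨⟨z, hzc⟩, c₃⟩, ?_,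
    ?_, ?_, ?_⟩) (not_lt.2 hends)
  · simp [ends, h₁, hc₁]
  · simp [ends, h₂, hc₂]
  · simp [ends, h₃, hc₃]
  · simpa using hne.1
  · simpa using hne.2.1
  · simpa using hne.2.2

end Recoloring

section Shifting

variable {V C : Type*} {G : SimpleGraph V} {χ : Sym2 V → Option C}

theorem IsUFan.color_mem_missing {f : UFan V C} (hf : IsUFan G χ f) (i : Fin 3) :
    f.color i ∈ missing G χ (f.vertex i) := by
  obtain ⟨-, -, -, -, -, hu, hv, hw, -, -⟩ := hf
  fin_cases i
  exacts [hu, hv, hw]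

theorem IsUFan.vertex_injective {f : UFan V C} (hf : IsUFan G χ f) :
    Function.Injective f.vertex := by
  obtain ⟨h₁, h₂, h₃, -⟩ := hf
  intro i j h
  fin_cases i <;> fin_cases j <;> simp_all [UFan.vertex, eq_comm]

theorem Separable.eq_of_vertex_of_color {𝒰 : Finset (UFan V C)} (h : Separable 𝒰)
    {f g : UFan V C} (hf : f ∈ 𝒰) (hg : g ∈ 𝒰) {i j : Fin 3}
    (hv : f.vertex i = g.vertex j) (hc : f.color i = g.color j) : f = g := by
  by_contra hne
  exact h.2 f hf g hg hne _ _ ((f.assigns_iff _ _).2 ⟨i, rfl, rfl⟩)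
    ((g.assigns_iff _ _).2 ⟨j, hv.symm, hc.symm⟩)

/-- The colors of a fan whose leaves have color `γ` and whose center has color `σ γ`. -/
def targetColor (σ : Equiv.Perm C) (γ : C) : Fin 3 → C := ![σ γ, γ, γ]

variable (G χ) in
/-- `g` has a vertex whose color may change when Kempe chains are switched
to give `f` the colors `targetColor σ γ`. -/
def Touches (σ : Equiv.Perm C) (γ : C) (f g : UFan V C) : Prop :=
  ∃ i j, (g.color j = f.color i ∨ g.color j = targetColor σ γ i) ∧
    (kempeGraph G χ (f.color i) (targetColor σ γ i)).Reachable (f.vertex i) (g.vertex j)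

theorem kempeGraph_reachable_iff {a b c : C} {v x y : V} (h : G.Adj x y)
    (hc : χ s(x, y) = some c) (hab : c = a ∨ c = b) :
    (kempeGraph G χ a b).Reachable v x ↔ (kempeGraph G χ a b).Reachable v y := by
  have hxy : (kempeGraph G χ a b).Adj x y := ⟨h, by rcases hab with rfl | rfl <;> simp [hc]⟩
  exact ⟨fun h => h.trans hxy.reachable, fun h => h.trans hxy.symm.reachable⟩

/-- Switching the Kempe chains at the vertices of a fan gives the fan any colors `σ γ`, `γ`. -/
theorem exists_perm_of_isUFan {f : UFan V C} (hf : IsUFan G χ f) (σ : Equiv.Perm C) (γ : C)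
    (h₁ : γ ≠ f.cu) (h₂ : γ ≠ f.cv) (h₃ : σ γ ≠ f.cv) (h₄ : σ γ ≠ γ) :
    ∃ π : V → Equiv.Perm C,
      (∀ x y c, G.Adj x y → χ s(x, y) = some c → π x c = π y c) ∧
      (∀ i, π (f.vertex i) (f.color i) = targetColor σ γ i) ∧
      ∀ x c, π x c ≠ c → ∃ i, (c = f.color i ∨ c = targetColor σ γ i) ∧
        (kempeGraph G χ (f.color i) (targetColor σ γ i)).Reachable (f.vertex i) x := by
  obtain ⟨-, -, -, -, -, -, -, -, h₆, h₇⟩ := hf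
  obtain ⟨P, hP⟩ : ∃ P : V → Prop, ∀ x, P x ↔ (kempeGraph G χ f.cv γ).Reachable f.v x ∨
    (kempeGraph G χ f.cv γ).Reachable f.w x := ⟨_, fun _ => Iff.rfl⟩
  obtain ⟨Q, hQ⟩ : ∃ Q : V → Prop, ∀ x, Q x ↔ (kempeGraph G χ f.cu (σ γ)).Reachable f.u x :=
    ⟨_, fun _ => Iff.rfl⟩
  let p : V → Equiv.Perm C := fun x => if P x then Equiv.swap f.cv γ else 1
  let q : V → Equiv.Perm C := fun x => if Q x then Equiv.swap f.cu (σ γ) else 1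
  have hp : ∀ x c, p x c = if P x then (if c = f.cv then γ else if c = γ then f.cv else c)
      else c := by
    intro x c
    by_cases h : P x <;> simp [p, h, Equiv.swap_apply_def]
  have hq : ∀ x c, q x c = if Q x then (if c = f.cu then σ γ else if c = σ γ then f.cu else c)
      else c := by
    intro x c
    by_cases h : Q x <;> simp [q, h, Equiv.swap_apply_def]
  refine ⟨fun x => p x * q x, ?_, ?_, ?_⟩
  · intro x y c hxy hc
    have hPxy : c = f.cv ∨ c = γ → (P x ↔ P y) := fun h => by
      rw [hP, hP, kempeGraph_reachable_iff hxy hc h, kempeGraph_reachable_iff hxy hc h]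
    have hQxy : c = f.cu ∨ c = σ γ → (Q x ↔ Q y) := fun h => by
      rw [hQ, hQ, kempeGraph_reachable_iff hxy hc h]
    clear hP hQ
    simp only [Equiv.Perm.mul_apply, hp, hq]
    grind
  · have hv : P f.v := (hP _).2 (Or.inl (SimpleGraph.Reachable.refl _))
    have hw : P f.w := (hP _).2 (Or.inr (SimpleGraph.Reachable.refl _))
    have hu : Q f.u := (hQ _).2 (SimpleGraph.Reachable.refl _)
    clear hP hQ
    intro i
    fin_cases i <;> simp only [UFan.vertex, UFan.color, targetColor, Equiv.Perm.mul_apply, hp, hq]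
      <;> simp <;> grind
  · intro x c hc
    simp only [Equiv.Perm.mul_apply, hp, hq] at hc
    have h : ((c = f.cu ∨ c = σ γ) ∧ Q x) ∨ ((c = f.cv ∨ c = γ) ∧ P x) := by
      clear hP hQ
      grind
    rw [hP, hQ] at h
    rcases h with ⟨h, hx⟩ | ⟨h, hx | hx⟩
    · exact ⟨0, h, hx⟩
    · exact ⟨1, h, hx⟩
    · refine ⟨2, ?_, ?_⟩
      · change c = f.cw ∨ c = γ
        rwa [← h₇]
      · change (kempeGraph G χ f.cw γ).Reachable f.w x
        rwa [← h₇]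

variable [Fintype V] {𝒰 : Finset (UFan V C)}

/-- Switching the Kempe chains of a fan affects at most three other fans. -/
theorem card_touches_le (hχ : Proper G χ) (h𝒰 : ∀ f ∈ 𝒰, IsUFan G χ f) (hsep : Separable 𝒰)
    (σ : Equiv.Perm C) (γ : C) {f : UFan V C} (hf : f ∈ 𝒰) :
    ((𝒰.erase f).filter (Touches G χ σ γ f)).card ≤ 3 := by
  refine (Finset.card_le_card_of_forall_subsingleton (t := (Finset.univ : Finset (Fin 3)))
    (fun g i => ∃ j, (g.color j = f.color i ∨ g.color j = targetColor σ γ i) ∧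
      (kempeGraph G χ (f.color i) (targetColor σ γ i)).Reachable (f.vertex i) (g.vertex j))
    ?_ ?_).trans (by simp)
  · intro g hg
    obtain ⟨i, h⟩ := (Finset.mem_filter.1 hg).2
    exact ⟨i, Finset.mem_univ i, h⟩
  · rintro i - g ⟨hg, j, hgc, hgr⟩ g' ⟨hg', j', hgc', hgr'⟩
    obtain ⟨hgf, hg⟩ := Finset.mem_erase.1 (Finset.mem_filter.1 hg).1
    obtain ⟨hgf', hg'⟩ := Finset.mem_erase.1 (Finset.mem_filter.1 hg').1
    rcases kempe_chain_ends hχ hgr hgr' ((h𝒰 f hf).color_mem_missing i)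
      ((h𝒰 g hg).color_mem_missing j) ((h𝒰 g' hg').color_mem_missing j') (Or.inl rfl) hgc hgc'
      with ⟨h, h'⟩ | ⟨h, h'⟩ | ⟨h, h'⟩
    · exact absurd (hsep.eq_of_vertex_of_color hf hg h h').symm hgf
    · exact absurd (hsep.eq_of_vertex_of_color hf hg' h h').symm hgf'
    · exact hsep.eq_of_vertex_of_color hg hg' h h'

/-- If the fans with colors outside `Z` outnumber those with colors in `Z`, then the chains of
some fan of the former kind can be switched without affecting any fan of the latter kind. -/
theorem exists_forall_not_touches [Fintype C] (hχ : Proper G χ) {B S : Finset (UFan V C)}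
    (hfan : ∀ f ∈ B ∪ S, IsUFan G χ f) (hsep : Separable (B ∪ S)) {Z : Finset C}
    {σ : Equiv.Perm C} (hB : ∀ f ∈ B, ∀ i, f.color i ∉ Z)
    (hS : ∀ f ∈ S, ∀ i, f.color i ∈ Z)
    (hcard : S.card * (3 * Zᶜ.card) < B.card * Z.card) :
    ∃ f ∈ B, ∃ γ ∈ Z, ∀ g ∈ S, ¬ Touches G χ σ γ f g := by
  by_contra! hcon
  have hle : (B ×ˢ Z).card ≤ (S ×ˢ ((Finset.univ : Finset (Fin 3)) ×ˢ Zᶜ)).card := by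
    refine Finset.card_le_card_of_forall_subsingleton
      (fun (a : UFan V C × C) (b : UFan V C × (Fin 3 × C)) =>
        ∃ i, a.1.color i = b.2.2 ∧ targetColor σ a.2 i = b.1.color b.2.1 ∧
          (kempeGraph G χ b.2.2 (b.1.color b.2.1)).Reachable (b.1.vertex b.2.1) (a.1.vertex i))
      ?_ ?_
    · rintro ⟨f, γ⟩ hfγ
      obtain ⟨hf, hγ⟩ := Finset.mem_product.1 hfγ
      obtain ⟨g, hg, i, j, hc, hr⟩ := hcon f hf γ hγ
      rcases hc with hc | hc
      · exact absurd (hc ▸ hS g hg j) (hB f hf i)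
      · exact ⟨(g, j, f.color i), by simp [hg, hB f hf i], i, rfl, hc.symm, by
          simpa [hc] using hr.symm⟩
    · rintro ⟨g, j, c⟩ hgjc ⟨f, γ⟩ ⟨hfγ, i, hi, ht, hr⟩ ⟨f', γ'⟩ ⟨hfγ', i', hi', ht', hr'⟩
      simp only [Finset.mem_product, Finset.mem_compl] at hgjc hfγ hfγ' hi ht hr hi' ht' hr'
      have hg := Finset.mem_union_right B hgjc.1
      have hf := Finset.mem_union_left S hfγ.1
      have hf' := Finset.mem_union_left S hfγ'.1
      have hne : g.color j ≠ c := fun h => hgjc.2.2 (h ▸ hS g hgjc.1 j)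
      have hend := kempe_chain_ends hχ hr hr' ((hfan g hg).color_mem_missing j)
        ((hfan f hf).color_mem_missing i) ((hfan f' hf').color_mem_missing i')
        (Or.inr rfl) (Or.inl hi) (Or.inl hi')
      rw [hi, hi'] at hend
      obtain ⟨hv, -⟩ : f.vertex i = f'.vertex i' ∧ c = c := by tauto
      obtain rfl := hsep.eq_of_vertex_of_color hf hf' hv (hi.trans hi'.symm)
      obtain rfl := (hfan f hf).vertex_injective hv
      have hγ : γ = γ' := by
        have h := ht.trans ht'.symm
        fin_cases i
        · exact σ.injective h
        · exact h
        · exact h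
      rw [hγ]
  simp only [Finset.card_product, Finset.card_univ, Fintype.card_fin] at hle
  omega

end Shifting

section Sparsify

variable {V C : Type*} {G : SimpleGraph V} {χ χ₀ : Sym2 V → Option C} {Z : Finset C}
  {σ : Equiv.Perm C} {B S : Finset (UFan V C)}

/-- A recoloring `χ` of `χ₀` with a separable collection of fans, of which those in `B` have colors
outside `Z`, and those in `S` have colors `σ γ`, `γ` for some `γ ∈ Z`. -/
structure IsPartialSparsification (G : SimpleGraph V) (χ₀ : Sym2 V → Option C) (Z : Finset C)
    (σ : Equiv.Perm C) (χ : Sym2 V → Option C) (B S : Finset (UFan V C)) : Prop where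
  proper : Proper G χ
  uncolored_eq : uncolored G χ = uncolored G χ₀
  isUFan : ∀ f ∈ B ∪ S, IsUFan G χ f
  separable : Separable (B ∪ S)
  color_notMem : ∀ f ∈ B, ∀ i, f.color i ∉ Z
  color_eq : ∀ f ∈ S, f.cv ∈ Z ∧ ∀ i, f.color i = targetColor σ f.cv i

theorem targetColor_mem (hσ : ∀ c ∈ Z, σ c ∈ Z) {γ : C} (hγ : γ ∈ Z) (i : Fin 3) :
    targetColor σ γ i ∈ Z := by
  fin_cases i
  exacts [hσ γ hγ, hγ, hγ]

theorem IsPartialSparsification.color_mem (h : IsPartialSparsification G χ₀ Z σ χ B S)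
    (hσ : ∀ c ∈ Z, σ c ∈ Z) {f : UFan V C} (hf : f ∈ S) (i : Fin 3) : f.color i ∈ Z := by
  obtain ⟨hZ, hc⟩ := h.color_eq f hf
  rw [hc]
  exact targetColor_mem hσ hZ i

/-- A fan keeps being a fan under a recoloring if its vertices keep missing suitable colors. -/
theorem IsUFan.of_uncolored_eq {χ' : Sym2 V → Option C} {f f' : UFan V C} (hf : IsUFan G χ f)
    (hχ : uncolored G χ' = uncolored G χ) (hv : f'.vertex = f.vertex)
    (hc : ∀ i, f'.color i ∈ missing G χ' (f'.vertex i)) (hne : f'.cu ≠ f'.cv)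
    (heq : f'.cv = f'.cw) : IsUFan G χ' f' := by
  obtain ⟨h₁, h₂, h₃, h₄, h₅, -⟩ := hf
  have hu : f'.u = f.u := congrFun hv 0
  have hv' : f'.v = f.v := congrFun hv 1
  have hw : f'.w = f.w := congrFun hv 2
  refine ⟨?_, ?_, ?_, ?_, ?_, hc 0, hc 1, hc 2, hne, heq⟩ <;> simpa only [hu, hv', hw, hχ]

theorem IsPartialSparsification.exists_step [Fintype V] [Fintype C]
    (h : IsPartialSparsification G χ₀ Z σ χ B S)
    (hσ : ∀ c ∈ Z, σ c ∈ Z) (hσ' : ∀ c ∈ Z, σ c ≠ c)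
    (hcard : S.card * (3 * Zᶜ.card) < B.card * Z.card) :
    ∃ χ' B' S', IsPartialSparsification G χ₀ Z σ χ' B' S' ∧ S'.card = S.card + 1 ∧
      B'.card < B.card ∧ B.card ≤ B'.card + 4 := by
  obtain ⟨f, hfB, γ, hγ, hfS⟩ := exists_forall_not_touches (σ := σ) h.proper h.isUFan h.separable
    h.color_notMem (fun f hf i => h.color_mem hσ hf i) hcard
  have hf : f ∈ B ∪ S := Finset.mem_union_left S hfB
  have hfan := h.isUFan f hf
  have hcu : f.cu ∉ Z := h.color_notMem f hfB 0
  have hcv : f.cv ∉ Z := h.color_notMem f hfB 1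
  obtain ⟨π, hπ, hπf, hπt⟩ := exists_perm_of_isUFan hfan σ γ (fun h => hcu (h ▸ hγ))
    (fun h => hcv (h ▸ hγ)) (fun h => hcv (h ▸ hσ γ hγ)) (hσ' γ hγ)
  obtain ⟨χ', hχ', hunc, hmiss⟩ := exists_recoloring h.proper π hπ
  let f' : UFan V C := ⟨f.u, f.v, f.w, σ γ, γ, γ⟩
  have hf'c : ∀ i, f'.color i = π (f.vertex i) (f.color i) := fun i => (hπf i).symm
  let B' := (B.erase f).filter (¬ Touches G χ σ γ f ·)
  have hSB : Disjoint B S := Finset.disjoint_left.2 fun g hgB hgS =>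
    h.color_notMem g hgB 0 (h.color_mem hσ hgS 0)
  have hold : ∀ g ∈ B' ∪ S, g ∈ B ∪ S ∧ g ≠ f ∧ ¬ Touches G χ σ γ f g := by
    intro g hg
    rcases Finset.mem_union.1 hg with hg | hg
    · obtain ⟨hg, ht⟩ := Finset.mem_filter.1 hg
      obtain ⟨hne, hg⟩ := Finset.mem_erase.1 hg
      exact ⟨Finset.mem_union_left S hg, hne, ht⟩
    · exact ⟨Finset.mem_union_right B hg,
        fun h => Finset.disjoint_left.1 hSB hfB (h ▸ hg), hfS g hg⟩
  have hfix : ∀ g ∈ B' ∪ S, ∀ i, π (g.vertex i) (g.color i) = g.color i := by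
    intro g hg i
    by_contra hne
    obtain ⟨j, hj⟩ := hπt _ _ hne
    exact (hold g hg).2.2 ⟨j, i, hj⟩
  have hmem : ∀ g ∈ B' ∪ insert f' S, g = f' ∨ g ∈ B' ∪ S := by
    intro g hg
    simp only [Finset.mem_union, Finset.mem_insert] at hg ⊢
    tauto
  have hdisj : ∀ g ∈ B' ∪ S, Disjoint g.edges f'.edges := fun g hg =>
    h.separable.1 g (hold g hg).1 f hf (hold g hg).2.1
  have hcol : ∀ g ∈ B' ∪ S, ∀ x c, g.assigns x c → ¬ f'.assigns x c := by
    intro g hg x c hgx hfx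
    obtain ⟨i, rfl, rfl⟩ := (g.assigns_iff _ _).1 hgx
    obtain ⟨j, hv, hc⟩ := (f'.assigns_iff _ _).1 hfx
    have hv : f.vertex j = g.vertex i := hv
    rw [hf'c, ← hfix g hg i, hv] at hc
    exact (hold g hg).2.1
      (h.separable.eq_of_vertex_of_color (hold g hg).1 hf hv.symm ((π _).injective hc).symm)
  have hf'S : f' ∉ S := by
    intro hf'
    exact Set.disjoint_left.1 (hdisj f' (Finset.mem_union_right B' hf'))
      (Set.mem_insert _ _) (Set.mem_insert _ _)
  refine ⟨χ', B', insert f' S, ⟨hχ', hunc.trans h.uncolored_eq, ?_, ⟨?_, ?_⟩, ?_, ?_⟩,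
    Finset.card_insert_of_notMem hf'S, ?_, ?_⟩
  · intro g hg
    rcases hmem g hg with rfl | hg
    · refine hfan.of_uncolored_eq hunc rfl (fun i => ?_) (hσ' γ hγ) rfl
      rw [hf'c]
      exact hmiss _ _ (hfan.color_mem_missing i)
    · have hgf := h.isUFan g (hold g hg).1
      refine hgf.of_uncolored_eq hunc rfl (fun i => ?_) hgf.2.2.2.2.2.2.2.2.1
        hgf.2.2.2.2.2.2.2.2.2
      rw [← hfix g hg i]
      exact hmiss _ _ (hgf.color_mem_missing i)
  · intro g hg g' hg' hne
    rcases hmem g hg with rfl | hg <;> rcases hmem g' hg' with rfl | hg'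
    · exact absurd rfl hne
    · exact (hdisj g' hg').symm
    · exact hdisj g hg
    · exact h.separable.1 g (hold g hg).1 g' (hold g' hg').1 hne
  · intro g hg g' hg' hne x c hx hx'
    rcases hmem g hg with rfl | hg <;> rcases hmem g' hg' with rfl | hg'
    · exact hne rfl
    · exact hcol g' hg' x c hx' hx
    · exact hcol g hg x c hx hx'
    · exact h.separable.2 g (hold g hg).1 g' (hold g' hg').1 hne x c hx hx'
  · intro g hg
    exact h.color_notMem g (Finset.mem_of_mem_erase (Finset.mem_filter.1 hg).1)
  · intro g hg
    rcases Finset.mem_insert.1 hg with rfl | hg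
    · exact ⟨hγ, fun i => rfl⟩
    · exact h.color_eq g hg
  · exact (Finset.card_filter_le _ _).trans_lt (Finset.card_erase_lt_of_mem hfB)
  · have h₁ := card_touches_le h.proper h.isUFan h.separable σ γ hf
    have h₂ : ((B.erase f).filter (Touches G χ σ γ f)).card ≤ 3 := (Finset.card_le_card
      (Finset.filter_subset_filter _ (Finset.erase_subset_erase f Finset.subset_union_left))).trans
      h₁
    have h₃ := Finset.card_filter_add_card_filter_not (s := B.erase f) (Touches G χ σ γ f)
    have h₄ := Finset.card_erase_add_one hfB
    change _ + B'.card = _ at h₃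
    omega

theorem IsPartialSparsification.exists_terminal [Fintype V] [Fintype C]
    (hσ : ∀ c ∈ Z, σ c ∈ Z) (hσ' : ∀ c ∈ Z, σ c ≠ c) (n : ℕ) :
    ∀ {χ B S}, IsPartialSparsification G χ₀ Z σ χ B S → B.card = n →
      ∃ χ' B' S', IsPartialSparsification G χ₀ Z σ χ' B' S' ∧
        B.card + 4 * S.card ≤ B'.card + 4 * S'.card ∧
        B'.card * Z.card ≤ S'.card * (3 * Zᶜ.card) := by
  induction n using Nat.strong_induction_on with
  | _ n ih =>
    intro χ B S h hn
    by_cases hcard : B.card * Z.card ≤ S.card * (3 * Zᶜ.card)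
    · exact ⟨χ, B, S, h, le_rfl, hcard⟩
    · obtain ⟨χ₁, B₁, S₁, h₁, hS, hlt, hle⟩ := h.exists_step hσ hσ' (not_le.1 hcard)
      obtain ⟨χ', B', S', h', hle', hcard'⟩ := ih B₁.card (hn ▸ hlt) h₁ rfl
      exact ⟨χ', B', S', h', by omega, hcard'⟩

/-- Of three disjoint sets of colors, some one avoids the types of a third of the fans. -/
theorem exists_card_le_three_mul_filter (𝒰 : Finset (UFan V C)) {P : Fin 3 → Finset C}
    (hP : ∀ i j, i ≠ j → Disjoint (P i) (P j)) :
    ∃ i, 𝒰.card ≤ 3 * (𝒰.filter fun f => f.cu ∉ P i ∧ f.cv ∉ P i).card := by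
  have hex : ∀ f : UFan V C, ∃ i, f.cu ∉ P i ∧ f.cv ∉ P i := by
    intro f
    have h01 := Finset.disjoint_left.1 (hP 0 1 (by decide))
    have h02 := Finset.disjoint_left.1 (hP 0 2 (by decide))
    have h12 := Finset.disjoint_left.1 (hP 1 2 (by decide))
    simp only [Fin.exists_fin_succ, Fin.succ_zero_eq_one, Fin.succ_one_eq_two]
    grind
  choose p hp using hex
  have hsum := Finset.card_eq_sum_card_fiberwise (s := 𝒰) (t := Finset.univ) (f := p) (by simp)
  obtain ⟨i, -, hi⟩ := Finset.exists_le_of_sum_le (s := (Finset.univ : Finset (Fin 3)))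
    (f := fun _ => 𝒰.card) (g := fun i => 3 * (𝒰.filter fun f => p f = i).card)
    Finset.univ_nonempty (by rw [← Finset.mul_sum, ← hsum]; simp)
  refine ⟨i, hi.trans (Nat.mul_le_mul_left 3 (Finset.card_le_card ?_))⟩
  exact Finset.monotone_filter_right _ fun f _ hf => hf ▸ hp f

end Sparsify

/-- **Lemma 3.1 (existential content of Sparsify-Types).** -/
theorem sparsify_types_exists
    {V C : Type*} [Fintype V] [Fintype C]
    (G : SimpleGraph V) (χ : Sym2 V → Option C) (hproper : Proper G χ)
    (𝒰 : Finset (UFan V C)) (h𝒰 : ∀ f ∈ 𝒰, IsUFan G χ f) (hsep : Separable 𝒰)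
    (η : ℕ) (hη₁ : 10 ≤ η) (hη₂ : 10 * η ≤ Fintype.card C) :
    ∃ (χ' : Sym2 V → Option C) (𝒞 : Fin η → Finset C) (𝒰' : Finset (UFan V C)),
      Proper G χ' ∧ uncolored G χ' = uncolored G χ ∧
      (∀ k l : Fin η, k ≠ l → Disjoint (𝒞 k) (𝒞 l)) ∧
      (∀ k : Fin η, (𝒞 k).card * η ≤ Fintype.card C) ∧
      (∀ f ∈ 𝒰', IsUFan G χ' f) ∧ Separable 𝒰' ∧
      𝒰.card ≤ 100 * 𝒰'.card ∧
      (∀ f ∈ 𝒰', ∃ k : Fin η, f.cu ∈ 𝒞 k ∧ f.cv ∈ 𝒞 k) := by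
  obtain ⟨s, hs⟩ : ∃ s, s = Fintype.card C / (3 * η) := ⟨_, rfl⟩
  have hle : s * (3 * η) ≤ Fintype.card C := hs ▸ Nat.div_mul_le_self _ _
  have hlt : Fintype.card C < (s + 1) * (3 * η) := by
    rw [hs, mul_comm]
    exact Nat.lt_mul_div_succ _ (by omega)
  have hs3 : 3 ≤ s := by
    rw [hs, Nat.le_div_iff_mul_le (by omega)]
    omega
  obtain ⟨e⟩ : Nonempty (Fin 3 × Fin η × Fin s ↪ C) :=
    Function.Embedding.nonempty_of_card_le (by simp; linarith)
  obtain ⟨E, hE⟩ : ∃ E : Fin 3 → (Fin η × Fin s ↪ C), ∀ i a, E i a = e (i, a) :=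
    ⟨fun i => ⟨fun a => e (i, a), fun a b h => by simpa using h⟩, fun _ _ => rfl⟩
  obtain ⟨i, hi⟩ := exists_card_le_three_mul_filter 𝒰 (P := fun i => Finset.univ.map (E i)) (by
    intro i j hij
    rw [Finset.disjoint_left]
    rintro c hc hc'
    obtain ⟨a, -, rfl⟩ := Finset.mem_map.1 hc
    obtain ⟨b, -, hb⟩ := Finset.mem_map.1 hc'
    rw [hE, hE] at hb
    exact hij (congrArg Prod.fst (e.injective hb)).symm)
  generalize E i = ι at hi
  let Z : Finset C := Finset.univ.map ι
  let ρ : Equiv.Perm (Fin η × Fin s) := Equiv.prodCongr (Equiv.refl _) (finRotate s)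
  let σ : Equiv.Perm C := ρ.viaFintypeEmbedding ι
  have hσι : ∀ a, σ (ι a) = ι (ρ a) := fun a => ρ.viaFintypeEmbedding_apply_image ι a
  have hσ : ∀ c ∈ Z, σ c ∈ Z := by
    intro c hc
    obtain ⟨a, -, rfl⟩ := Finset.mem_map.1 hc
    simp [Z, hσι]
  have hσ' : ∀ c ∈ Z, σ c ≠ c := by
    intro c hc
    obtain ⟨a, -, rfl⟩ := Finset.mem_map.1 hc
    rw [hσι, ι.injective.ne_iff]
    intro h
    have h : finRotate s a.2 = a.2 := congrArg Prod.snd h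
    obtain ⟨t, rfl⟩ : ∃ t, s = t + 2 := ⟨s - 2, by omega⟩
    have hm : a.2 ∈ (finRotate (t + 2)).support := by rw [support_finRotate]; simp
    exact Equiv.Perm.mem_support.1 hm h
  let B := 𝒰.filter fun f => f.cu ∉ Z ∧ f.cv ∉ Z
  have hB : 𝒰.card ≤ 3 * B.card := hi
  have hstart : IsPartialSparsification G χ Z σ χ B ∅ := by
    have hsub : ∀ f ∈ B, f ∈ 𝒰 := fun f hf => (Finset.mem_filter.1 hf).1
    rw [← Finset.union_empty B] at hsub
    refine ⟨hproper, rfl, fun f hf => h𝒰 f (hsub f hf),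
      ⟨fun f hf g hg => hsep.1 f (hsub f hf) g (hsub g hg),
        fun f hf g hg => hsep.2 f (hsub f hf) g (hsub g hg)⟩, fun f hf i => ?_, by simp⟩
    obtain ⟨hf, hcu, hcv⟩ := Finset.mem_filter.1 hf
    have hcw : f.cw ∉ Z := (h𝒰 f hf).2.2.2.2.2.2.2.2.2 ▸ hcv
    fin_cases i
    exacts [hcu, hcv, hcw]
  obtain ⟨χ', B', S, h, hcard, hterm⟩ := IsPartialSparsification.exists_terminal hσ hσ' _ hstart rfl
  have hblock : ∀ k : Fin η, Function.Injective fun a : Fin s => ι (k, a) := by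
    intro k a b hab
    simpa using hab
  refine ⟨χ', fun k => Finset.univ.map ⟨fun a => ι (k, a), hblock k⟩, S, h.proper, h.uncolored_eq,
    ?_, ?_, fun f hf => h.isUFan f (Finset.mem_union_right B' hf), ?_, ?_, ?_⟩
  · intro k l hkl
    rw [Finset.disjoint_left]
    rintro c hc hc'
    obtain ⟨a, -, rfl⟩ := Finset.mem_map.1 hc
    obtain ⟨b, -, hb⟩ := Finset.mem_map.1 hc'
    exact hkl (congrArg Prod.fst (ι.injective hb)).symm
  · intro k
    simp only [Finset.card_map, Finset.card_univ, Fintype.card_fin]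
    nlinarith
  · exact ⟨fun f hf g hg => h.separable.1 f (Finset.mem_union_right B' hf) g
      (Finset.mem_union_right B' hg), fun f hf g hg => h.separable.2 f
      (Finset.mem_union_right B' hf) g (Finset.mem_union_right B' hg)⟩
  · have hZ : Z.card = η * s := by simp [Z]
    have hZc := Finset.card_add_card_compl Z
    have hZle : Zᶜ.card ≤ 3 * Z.card := by nlinarith
    have hZpos : 0 < Z.card := by rw [hZ]; positivity
    have hB' : B'.card ≤ 9 * S.card := by
      refine Nat.le_of_mul_le_mul_right (hterm.trans ?_) hZpos
      nlinarith [Nat.mul_le_mul_left (3 * S.card) hZle]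
    simp only [Finset.card_empty] at hcard
    omega
  · intro f hf
    obtain ⟨hcv, hcol⟩ := h.color_eq f hf
    obtain ⟨⟨k, a⟩, -, ha⟩ := Finset.mem_map.1 hcv
    have hcu : f.cu = σ f.cv := hcol 0
    refine ⟨k, ?_, ?_⟩
    · rw [hcu, ← ha, hσι]
      exact Finset.mem_map.2 ⟨finRotate s a, Finset.mem_univ _, rfl⟩
    · rw [← ha]
      exact Finset.mem_map.2 ⟨a, Finset.mem_univ _, rfl⟩
end

section
/- (Claim 5.1, abstract form.) Let μ and η be integers with 10 ≤ η ≤ μ/10 and set q = 2η⌊μ/(2η)⌋. For any finite indexed family (τ_s)_{s ∈ S} of λ = |S| unordered pairs of elements of {1, …, μ}, there exists a subset Q ⊆ {1, …, μ} with |Q| = q such that at least 3λ/5 of the indices s ∈ S satisfy τ_s ⊆ Q. (Equivalently, after relabeling the colors by a suitable permutation of [μ], at least 3λ/5 of the pairs have both elements in [q].) -/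
/-- A finite set has subsets of every smaller size whose average is at most the overall average. -/
theorem exists_subset_card_eq_mul_sum_le {α : Type*} [DecidableEq α] (f : α → ℕ) (r : ℕ)
    (A : Finset α) (hr : r ≤ A.card) :
    ∃ R ⊆ A, R.card = r ∧ A.card * ∑ x ∈ R, f x ≤ r * ∑ x ∈ A, f x := by
  induction hn : A.card generalizing A with
  | zero => exact ⟨∅, by simp, by simp; omega, by simp⟩
  | succ n ih =>
    rcases (hn ▸ hr).eq_or_lt with h | h
    · exact ⟨A, subset_rfl, by omega, by rw [h]⟩
    rcases r.eq_zero_or_pos with h0 | h0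
    · exact ⟨∅, by simp, by simp [h0], by simp⟩
    obtain ⟨m, hm, hmax⟩ := A.exists_max_image f (Finset.card_pos.mp (by omega))
    have hc : (A.erase m).card = n := by rw [Finset.card_erase_of_mem hm]; omega
    obtain ⟨R, hR, hRr, hle⟩ := ih (A.erase m) (by omega) hc
    refine ⟨R, hR.trans (Finset.erase_subset _ _), hRr, ?_⟩
    have hsum : ∑ x ∈ A.erase m, f x + f m = ∑ x ∈ A, f x := Finset.sum_erase_add A f hm
    have hmaxsum : ∑ x ∈ A.erase m, f x ≤ n * f m := by
      simpa [hc] using Finset.sum_le_card_nsmul (A.erase m) f (f m)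
        fun x hx => hmax x (Finset.mem_of_mem_erase hx)
    have hn0 : 0 < n := by omega
    refine Nat.le_of_mul_le_mul_left ?_ hn0
    calc n * ((n + 1) * ∑ x ∈ R, f x) = (n + 1) * (n * ∑ x ∈ R, f x) := by ring
      _ ≤ (n + 1) * (r * ∑ x ∈ A.erase m, f x) := by gcongr
      _ = r * (n * ∑ x ∈ A.erase m, f x + ∑ x ∈ A.erase m, f x) := by ring
      _ ≤ r * (n * ∑ x ∈ A.erase m, f x + n * f m) := by gcongr
      _ = n * (r * ∑ x ∈ A, f x) := by rw [← hsum]; ring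

/-- **Claim 5.1 (abstract form).** After relabeling colors, at least `3λ/5` of the pairs
have both elements in `[q]`, where `q = 2η⌊μ/(2η)⌋`. -/
theorem relabel_colors (μ η : ℕ) (hη₁ : 10 ≤ η) (hη₂ : 10 * η ≤ μ)
    {S : Type*} [Fintype S] [DecidableEq S]
    (τ : S → Finset ℕ)
    (hsub : ∀ s : S, τ s ⊆ Finset.Icc 1 μ) (hcard : ∀ s : S, (τ s).card ≤ 2) :
    ∃ Q ⊆ Finset.Icc 1 μ, Q.card = 2 * η * (μ / (2 * η)) ∧
      3 * Fintype.card S ≤ 5 * (Finset.univ.filter (fun s : S => τ s ⊆ Q)).card := by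
  set q := 2 * η * (μ / (2 * η))
  have hdiv : q + μ % (2 * η) = μ := Nat.div_add_mod μ (2 * η)
  have hmod : μ % (2 * η) < 2 * η := Nat.mod_lt _ (by omega)
  let deg : ℕ → ℕ := fun x => (Finset.univ.filter fun s : S => x ∈ τ s).card
  obtain ⟨R, hR, hRr, hle⟩ := exists_subset_card_eq_mul_sum_le deg (μ - q) (Finset.Icc 1 μ)
    (by simp)
  have hdeg : ∑ x ∈ Finset.Icc 1 μ, deg x ≤ 2 * Fintype.card S := by
    calc ∑ x ∈ Finset.Icc 1 μ, deg x
        = ∑ s : S, ((Finset.Icc 1 μ).filter fun x => x ∈ τ s).card :=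
          Finset.sum_card_bipartiteAbove_eq_sum_card_bipartiteBelow fun x s => x ∈ τ s
      _ ≤ ∑ _s : S, 2 := Finset.sum_le_sum fun s _ =>
          (Finset.card_le_card fun x hx => (Finset.mem_filter.mp hx).2).trans (hcard s)
      _ = 2 * Fintype.card S := by simp [mul_comm]
  refine ⟨Finset.Icc 1 μ \ R, Finset.sdiff_subset, ?_, ?_⟩
  · rw [Finset.card_sdiff_of_subset hR, hRr, Nat.card_Icc]
    omega
  have hbad : (Finset.univ.filter fun s : S => ¬ τ s ⊆ Finset.Icc 1 μ \ R).card
      ≤ ∑ x ∈ R, deg x := by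
    refine (Finset.card_le_card fun s hs => ?_).trans
      (Finset.card_biUnion_le (s := R) (t := fun x => Finset.univ.filter fun s : S => x ∈ τ s))
    obtain ⟨x, hx, hxR⟩ := Finset.not_subset.mp (Finset.mem_filter.mp hs).2
    have hxR' : x ∈ R := by
      by_contra h
      exact hxR (Finset.mem_sdiff.mpr ⟨hsub s hx, h⟩)
    exact Finset.mem_biUnion.mpr ⟨x, hxR', by simpa using hx⟩
  have hsplit := Finset.card_filter_add_card_filter_not (s := (Finset.univ : Finset S))
    (fun s => τ s ⊆ Finset.Icc 1 μ \ R)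
  rw [Finset.card_univ] at hsplit
  have hkey : 5 * ∑ x ∈ R, deg x ≤ 2 * Fintype.card S := by
    refine Nat.le_of_mul_le_mul_left ?_ (show 0 < μ by omega)
    rw [Nat.card_Icc, Nat.add_sub_cancel] at hle
    calc μ * (5 * ∑ x ∈ R, deg x) = 5 * (μ * ∑ x ∈ R, deg x) := by ring
      _ ≤ 5 * ((μ - q) * (2 * Fintype.card S)) :=
          Nat.mul_le_mul_left 5 (hle.trans (Nat.mul_le_mul_left _ hdeg))
      _ = (5 * (μ - q)) * (2 * Fintype.card S) := by ring
      _ ≤ μ * (2 * Fintype.card S) := by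
          gcongr
          omega
  omega
end

section
/- (Claim 3.1.) Let G be a finite simple graph with maximum degree Δ, let χ be a proper partial edge coloring of G with a palette C of size |C| ≥ Δ + 1, and let 𝒰 be a separable collection of u-fans. Then for every vertex x, the set miss_χ(x) \ C_𝒰(x) is non-empty, where C_𝒰(x) = {c_f(x) : f ∈ 𝒰, x ∈ f}. -/
open Classical

/-- A u-fan assigns at most one color to each vertex. -/
lemma IsUFan.assigns_unique {V C : Type*} {G : SimpleGraph V} {χ : Sym2 V → Option C}
    {f : UFan V C} (hf : IsUFan G χ f) {x : V} {c d : C}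
    (hc : f.assigns x c) (hd : f.assigns x d) : c = d := by
  obtain ⟨huv, huw, hvw, -⟩ := hf
  unfold UFan.assigns at hc hd
  grind

/-- Every vertex of a u-fan lies on one of its edges, which is an uncolored edge of the graph. -/
lemma IsUFan.exists_mem_edges {V C : Type*} {G : SimpleGraph V} {χ : Sym2 V → Option C}
    {f : UFan V C} (hf : IsUFan G χ f) {x : V} {c : C} (hc : f.assigns x c) :
    ∃ e ∈ f.edges, e ∈ uncolored G χ ∧ x ∈ e := by
  obtain ⟨-, -, -, hv, hw, -⟩ := hf
  rcases hc with ⟨rfl, -⟩ | ⟨rfl, -⟩ | ⟨rfl, -⟩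
  · exact ⟨_, Or.inl rfl, hv, Sym2.mem_mk_left _ _⟩
  · exact ⟨_, Or.inl rfl, hv, Sym2.mem_mk_right _ _⟩
  · exact ⟨_, Or.inr rfl, hw, Sym2.mem_mk_right _ _⟩

/-- **Claim 3.1.** For every vertex `x`, the set `miss_χ(x) \\ C_𝒰(x)` is non-empty. -/
theorem missing_sdiff_assigned_nonempty
    {V C : Type*} [Fintype V] [DecidableEq V] [Fintype C]
    (G : SimpleGraph V) [DecidableRel G.Adj]
    (χ : Sym2 V → Option C) (hproper : Proper G χ)
    (hpal : G.maxDegree + 1 ≤ Fintype.card C)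
    (𝒰 : Finset (UFan V C)) (h𝒰 : ∀ f ∈ 𝒰, IsUFan G χ f) (hsep : Separable 𝒰)
    (x : V) :
    (missing G χ x \ {c : C | ∃ f ∈ 𝒰, f.assigns x c}).Nonempty := by
  by_contra hempty
  have hwit : ∀ c : C, ∃ e : Sym2 V, e ∈ G.incidenceSet x ∧
      (χ e = some c ∨ (χ e = none ∧ ∃ f ∈ 𝒰, f.assigns x c ∧ e ∈ f.edges)) := by
    intro c
    by_cases hc : c ∈ missing G χ x
    · have hassigned : ∃ f ∈ 𝒰, f.assigns x c := by
        by_contra h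
        exact hempty ⟨c, hc, h⟩
      obtain ⟨f, hf, hfc⟩ := hassigned
      obtain ⟨e, hef, ⟨heG, he⟩, hxe⟩ := (h𝒰 f hf).exists_mem_edges hfc
      exact ⟨e, ⟨heG, hxe⟩, Or.inr ⟨he, f, hf, hfc, hef⟩⟩
    · simp only [missing, Set.mem_ofPred_eq] at hc
      push Not at hc
      obtain ⟨e, heG, hxe, he⟩ := hc
      exact ⟨e, ⟨heG, hxe⟩, Or.inl he⟩
  choose φ hφ hφc using hwit
  have hinj : Function.Injective φ := by
    intro c d hcd
    have hd := hφc d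
    rw [← hcd] at hd
    rcases hφc c with hc | ⟨hc, f, hf, hfc, hef⟩ <;> rcases hd with hd | ⟨hd, g, hg, hgd, heg⟩
    · exact Option.some.inj (hc.symm.trans hd)
    · simp [hc] at hd
    · simp [hc] at hd
    · have hfg : f = g := by
        by_contra hne
        exact Set.disjoint_left.mp (hsep.1 f hf g hg hne) hef heg
      subst hfg
      exact (h𝒰 f hf).assigns_unique hfc hgd
  have hcard : Fintype.card C ≤ (G.incidenceFinset x).card :=
    Finset.card_le_card_of_injOn φ (fun c _ => by simpa using hφ c) hinj.injOn
  rw [G.card_incidenceFinset_eq_degree] at hcard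
  have := G.degree_le_maxDegree x
  omega
end
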